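/- Theorem 2 (generalized self-similar ansatz, finite expansion). Let T ∈ ℝ, 0 < δ < 1, γ > 0, let N ≥ 0 be an integer, and let p be a positive even integer. Let (u₁, ω₁, ψ₁) be a classical solution of the reduced axisymmetric Euler system on 𝒞_{δ,T} = {(r,z,t) : 1−δ < r < 1, −δ < z < δ, T−δ < t < T}. Suppose there exist functions U_k, Ω_k : 𝒟 → ℝ, C¹ up to the boundary, and Ψ_k : 𝒟 → ℝ, C² up to the boundary, for k = 0, 1, …, N, such that for all (r,z,t) ∈ 𝒞_{δ,T}: u₁(r,z,t) = (T−t)^{−1+γ/2} Σ_{k=0}^{N} (T−t)^{kγ} U_k(R,Z), ω₁(r,z,t) = (T−t)^{−1} Σ_{k=0}^{N} (T−t)^{kγ} Ω_k(R,Z), ψ₁(r,z,t) = (T−t)^{−1+2γ} Σ_{k=0}^{N} (T−t)^{kγ} Ψ_k(R,Z), where R = (r−1)(T−t)^{−γ} and Z = z(T−t)^{−γ}. Assume for every k = 0, …, N: |U_k(Y)| + |Ω_k(Y)| → 0 and |∇Ψ_k(Y)|/|Y| → 0 as |Y| → ∞ (Y ∈ 𝒟); ∂_Z Ψ_k(0,Z)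 = 0 for every Z ∈ ℝ; and, for every k with k ≤ 1/γ, ∫_{{Y ∈ 𝒟 : ρ < |Y| < 2ρ}} (U_k(Y)^p + Ω_k(Y)^p) dY → 0 as ρ → ∞. Then u₁ ≡ 0 and ω₁ ≡ 0 on 𝒞_{δ,T}, and ∂ᵣψ₁ ≡ 0 and ∂_zψ₁ ≡ 0 on 𝒞_{δ,T}. -/

import Mathlib

open MeasureTheory Filter

/-- Partial derivative in the first (radial) variable. -/
noncomputable def pdr (f : ℝ → ℝ → ℝ → ℝ) : ℝ → ℝ → ℝ → ℝ :=
  fun r z t => deriv (fun s => f s z t) r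

/-- Partial derivative in the second (axial) variable. -/
noncomputable def pdz (f : ℝ → ℝ → ℝ → ℝ) : ℝ → ℝ → ℝ → ℝ :=
  fun r z t => deriv (fun s => f r s t) z

/-- Partial derivative in the time variable. -/
noncomputable def pdt (f : ℝ → ℝ → ℝ → ℝ) : ℝ → ℝ → ℝ → ℝ :=
  fun r z t => deriv (fun s => f r z s) t

/-- Partial derivative in the first variable (two-variable functions). -/
noncomputable def pd1 (f : ℝ → ℝ → ℝ) : ℝ → ℝ → ℝ := fun x y => deriv (fun s => f s y) x

/-- Partial derivative in the second variable (two-variable functions). -/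
noncomputable def pd2 (f : ℝ → ℝ → ℝ) : ℝ → ℝ → ℝ := fun x y => deriv (fun s => f x s) y


lemma hasDerivAt_maxpow (m : ℕ) (x : ℝ) :
    HasDerivAt (fun y : ℝ => (max y 0) ^ (m + 2)) ((m + 2 : ℕ) * (max x 0) ^ (m + 1)) x := by
  rcases lt_trichotomy x 0 with h | h | h
  · have : (fun y : ℝ => (max y 0) ^ (m + 2)) =ᶠ[nhds x] fun _ => 0 := by
      filter_upwards [Iio_mem_nhds h] with y hy
      rw [max_eq_right (le_of_lt hy)]; simp
    rw [max_eq_right h.le]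
    simpa using (hasDerivAt_const x (0 : ℝ)).congr_of_eventuallyEq this
  · subst h
    have h1 : HasDerivAt (fun y : ℝ => (max y 0) ^ (m + 2)) 0 0 := by
      rw [hasDerivAt_iff_isLittleO]
      have : (fun y : ℝ => y ^ 2) =o[nhds 0] fun y : ℝ => y ^ 1 :=
        Asymptotics.isLittleO_pow_pow (by norm_num)
      refine Asymptotics.IsBigO.trans_isLittleO ?_ (by simpa using this)
      refine Asymptotics.IsBigO.of_bound 1 ?_
      filter_upwards [Metric.ball_mem_nhds (0:ℝ) one_pos] with y hy
      have hy1 : |y| < 1 := by simpa using hy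
      have h0 : 0 ≤ max y 0 := le_max_right _ _
      have h2 : max y 0 ≤ |y| := max_le (le_abs_self y) (abs_nonneg y)
      simp only [max_self, ne_eq, Nat.add_eq_zero_iff, OfNat.ofNat_ne_zero, and_false,
        not_false_eq_true, zero_pow, sub_zero, smul_zero, one_mul, norm_pow, Real.norm_eq_abs]
      rw [abs_of_nonneg h0, pow_add]
      calc (max y 0) ^ m * (max y 0) ^ 2 ≤ 1 * |y| ^ 2 := by
            gcongr
            exact pow_le_one₀ h0 (by linarith)
        _ = _ := by simp
    simpa using h1
  · have : (fun y : ℝ => (max y 0) ^ (m + 2)) =ᶠ[nhds x] fun y => y ^ (m + 2) := by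
      filter_upwards [Ioi_mem_nhds h] with y hy
      rw [max_eq_left (le_of_lt hy)]
    rw [max_eq_left h.le]
    simpa using (hasDerivAt_pow (m + 2) x).congr_of_eventuallyEq this

lemma transport_zero (γ a : ℝ) (hγ : 0 < γ) (U V1 V2 : ℝ × ℝ → ℝ)
    (hU : ContinuousOn U {q | q.1 ≤ 0}) (hV1 : ContinuousOn V1 {q | q.1 ≤ 0})
    (hV2 : ContinuousOn V2 {q | q.1 ≤ 0})
    (dU : ∀ q : ℝ × ℝ, q.1 < 0 → DifferentiableAt ℝ U q)
    (dV1 : ∀ q : ℝ × ℝ, q.1 < 0 → DifferentiableAt ℝ V1 q)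
    (dV2 : ∀ q : ℝ × ℝ, q.1 < 0 → DifferentiableAt ℝ V2 q)
    (hdiv : ∀ q : ℝ × ℝ, q.1 < 0 → fderiv ℝ V1 q (1, 0) + fderiv ℝ V2 q (0, 1) = 2 * γ)
    (heq : ∀ q : ℝ × ℝ, q.1 < 0 →
      a * U q + V1 q * fderiv ℝ U q (1, 0) + V2 q * fderiv ℝ U q (0, 1) = 0)
    (hbd : ∀ Z, V1 (0, Z) = 0)
    (hdec : ∀ ε > 0, ∃ M : ℝ, ∀ R ≤ (0 : ℝ), ∀ Z : ℝ,
      M < Real.sqrt (R ^ 2 + Z ^ 2) → |U (R, Z)| < ε) :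
    ∀ q : ℝ × ℝ, q.1 ≤ 0 → U q = 0 := by
  have key : ∀ ε > 0, ∀ q : ℝ × ℝ, q.1 ≤ 0 → U q ^ 2 ≤ ε ^ 2 := by
    intro ε hε q hq
    obtain ⟨M0, hM0⟩ := hdec ε hε
    obtain ⟨m, σ, hσ⟩ : ∃ m : ℕ, ∃ σ : ℝ, ∀ x y : ℝ, 0 ≤ y → y ≤ x ^ 2 →
        2 * γ * y ≤ σ * (- a * x * (((m + 2 : ℕ) : ℝ) * (2 * x)) + 2 * γ * y) := by
      rcases le_or_gt a 0 with ha | ha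
      · refine ⟨0, 1, fun x y hy hyx => ?_⟩
        push_cast
        nlinarith [mul_nonneg (neg_nonneg.2 ha) (sq_nonneg x)]
      · obtain ⟨m, hm⟩ := exists_nat_ge (2 * γ / a)
        refine ⟨m, -1, fun x y hy hyx => ?_⟩
        rw [div_le_iff₀ ha] at hm
        have : 2 * γ ≤ ((m + 2 : ℕ) : ℝ) * a := by push_cast; nlinarith
        nlinarith [mul_le_mul this hyx hy (by positivity)]
    set h : ℝ × ℝ → ℝ := fun q => (max (U q ^ 2 - ε ^ 2) 0) ^ (m + 2) with hh
    set G : ℝ × ℝ → ℝ := fun q => (max (U q ^ 2 - ε ^ 2) 0) ^ (m + 1) *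
      (- a * U q * (((m + 2 : ℕ) : ℝ) * (2 * U q)) + 2 * γ * max (U q ^ 2 - ε ^ 2) 0) with hG
    have hch : ContinuousOn h {q | q.1 ≤ 0} := by
      apply ContinuousOn.pow
      exact (((hU.pow 2).sub continuousOn_const).sup continuousOn_const)
    have hcG : ContinuousOn G {q | q.1 ≤ 0} := by
      have h1 : ContinuousOn (fun q => max (U q ^ 2 - ε ^ 2) 0) {q | q.1 ≤ 0} :=
        (((hU.pow 2).sub continuousOn_const).sup continuousOn_const)
      rw [hG]
      fun_prop
    have dh : ∀ q : ℝ × ℝ, q.1 < 0 → HasFDerivAt h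
        ((((m + 2 : ℕ) : ℝ) * (max (U q ^ 2 - ε ^ 2) 0) ^ (m + 1) * (2 * U q)) • fderiv ℝ U q) q := by
      intro q hq
      have h1 := (dU q hq).hasFDerivAt
      have h2 : HasDerivAt (fun y : ℝ => (max (y ^ 2 - ε ^ 2) 0) ^ (m + 2))
        ((((m + 2 : ℕ) : ℝ) * (max (U q ^ 2 - ε ^ 2) 0) ^ (m + 1) * (2 * U q))) (U q) := by
        have h3 : HasDerivAt (fun y : ℝ => y ^ 2 - ε ^ 2) (2 * U q) (U q) := by
          simpa using (hasDerivAt_pow 2 (U q)).sub_const (ε ^ 2)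
        exact (hasDerivAt_maxpow m (U q ^ 2 - ε ^ 2)).comp (U q) h3
      exact h2.comp_hasFDerivAt q h1
    -- choose rectangle
    set M : ℝ := max (|M0| + 1) (max (|q.1| + 1) (|q.2| + 1)) with hM
    have hM1 : |M0| + 1 ≤ M := le_max_left _ _
    have hM2 : |q.1| + 1 ≤ M := (le_max_left _ _).trans (le_max_right _ _)
    have hM3 : |q.2| + 1 ≤ M := (le_max_right _ _).trans (le_max_right _ _)
    have hMpos : 0 < M := by linarith [abs_nonneg M0]
    have hzero : ∀ R ≤ (0:ℝ), ∀ Z, M ^ 2 ≤ R ^ 2 + Z ^ 2 → h (R, Z) = 0 := by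
      intro R hR Z hRZ
      have h1 : M ≤ Real.sqrt (R ^ 2 + Z ^ 2) := Real.le_sqrt_of_sq_le hRZ
      have h2 := hM0 R hR Z (by linarith [le_abs_self M0])
      have h3 : U (R, Z) ^ 2 ≤ ε ^ 2 := by
        rw [← sq_abs]; gcongr
      simp only [hh]
      rw [max_eq_right (by linarith)]; simp
    have hsub : Set.Icc ((-M, -M) : ℝ × ℝ) (0, M) ⊆ {q | q.1 ≤ 0} := fun x hx => hx.2.1
    have hdivthm := integral_divergence_prod_Icc_of_hasFDerivAt_of_le
      (fun q => h q * V1 q) (fun q => h q * V2 q)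
      (fun q => if q.1 < 0 then fderiv ℝ (fun q => h q * V1 q) q
        else (G q) • ContinuousLinearMap.fst ℝ ℝ ℝ)
      (fun q => if q.1 < 0 then fderiv ℝ (fun q => h q * V2 q) q else 0)
      (-M, -M) (0, M) ⟨by simpa using hMpos.le, by simpa using (by linarith : -M ≤ M)⟩
      ((hch.mul hV1).mono hsub) ((hch.mul hV2).mono hsub)
      (by
        rintro x ⟨hx1, hx2⟩
        have hx : x.1 < 0 := hx1.2
        simp only [hx, if_true]
        exact ((dh x hx).differentiableAt.mul (dV1 x hx)).hasFDerivAt)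
      (by
        rintro x ⟨hx1, hx2⟩
        have hx : x.1 < 0 := hx1.2
        simp only [hx, if_true]
        exact ((dh x hx).differentiableAt.mul (dV2 x hx)).hasFDerivAt)
    have hfun : (fun x : ℝ × ℝ => (if x.1 < 0 then fderiv ℝ (fun q => h q * V1 q) x
        else (G x) • ContinuousLinearMap.fst ℝ ℝ ℝ) (1, 0) +
        (if x.1 < 0 then fderiv ℝ (fun q => h q * V2 q) x else 0) (0, 1)) = G := by
      funext x
      by_cases hx : x.1 < 0
      · simp only [hx, if_true]
        have e1 := ((dh x hx).mul (dV1 x hx).hasFDerivAt).fderiv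
        have e2 := ((dh x hx).mul (dV2 x hx).hasFDerivAt).fderiv
        have e1' : fderiv ℝ (fun q => h q * V1 q) x = _ := e1
        have e2' : fderiv ℝ (fun q => h q * V2 q) x = _ := e2
        rw [e1', e2']
        simp only [add_apply, smul_apply, smul_eq_mul]
        have d := hdiv x hx
        have e := heq x hx
        have hx' : h x = (max (U x ^ 2 - ε ^ 2) 0) ^ (m + 1) * max (U x ^ 2 - ε ^ 2) 0 := by
          simp only [hh]; rw [pow_succ]
        rw [hx']
        simp only [hG]
        linear_combination (max (U x ^ 2 - ε ^ 2) 0) ^ (m + 1) * max (U x ^ 2 - ε ^ 2) 0 * d +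
          (((m + 2 : ℕ) : ℝ) * (max (U x ^ 2 - ε ^ 2) 0) ^ (m + 1) * (2 * U x)) * e
      · simp [hx]
    rw [hfun] at hdivthm
    have hint : IntegrableOn G (Set.Icc ((-M, -M) : ℝ × ℝ) (0, M)) :=
      (hcG.mono hsub).integrableOn_compact isCompact_Icc
    have hGh : ∀ x, 2 * γ * h x ≤ σ * G x := by
      intro x
      have h0 : 0 ≤ max (U x ^ 2 - ε ^ 2) 0 := le_max_right _ _
      have := hσ (U x) (max (U x ^ 2 - ε ^ 2) 0) h0
        (max_le (by nlinarith [sq_nonneg ε]) (sq_nonneg _))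
      have h2 := mul_le_mul_of_nonneg_left this (pow_nonneg h0 (m + 1))
      simp only [hh, hG]
      rw [pow_succ _ (m+1)]
      linarith
    have hh0 : ∀ x, 0 ≤ h x := fun x => pow_nonneg (le_max_right _ _) _
    have hI0 : ∫ x in Set.Icc ((-M, -M) : ℝ × ℝ) (0, M), G x = 0 := by
      rw [hdivthm hint]
      have i1 : ∫ x in (-M)..0, h (x, M) * V2 (x, M) = 0 := by
        rw [intervalIntegral.integral_congr (g := fun _ => 0)]
        · simp
        · intro x hx
          rw [Set.uIcc_of_le (by linarith)] at hx
          simp [hzero x hx.2 M (by nlinarith [sq_nonneg x])]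
      have i2 : ∫ x in (-M)..0, h (x, -M) * V2 (x, -M) = 0 := by
        rw [intervalIntegral.integral_congr (g := fun _ => 0)]
        · simp
        · intro x hx
          rw [Set.uIcc_of_le (by linarith)] at hx
          simp [hzero x hx.2 (-M) (by nlinarith [sq_nonneg x])]
      have i3 : ∫ y in (-M)..M, h (-M, y) * V1 (-M, y) = 0 := by
        rw [intervalIntegral.integral_congr (g := fun _ => 0)]
        · simp
        · intro x hx
          simp [hzero (-M) (by linarith) x (by nlinarith [sq_nonneg x])]
      simp [i1, i2, i3, hbd]
    have hIh : ∫ x in Set.Icc ((-M, -M) : ℝ × ℝ) (0, M), h x = 0 := by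
      have hinth : IntegrableOn h (Set.Icc ((-M, -M) : ℝ × ℝ) (0, M)) :=
        (hch.mono hsub).integrableOn_compact isCompact_Icc
      apply le_antisymm _ (integral_nonneg hh0)
      have := integral_mono (hinth.const_mul (2 * γ)) (hint.const_mul σ) hGh
      rw [integral_const_mul, integral_const_mul, hI0] at this
      nlinarith
    have hae : h =ᵐ[volume.restrict (Set.Icc ((-M, -M) : ℝ × ℝ) (0, M))] 0 := by
      refine (integral_eq_zero_iff_of_nonneg hh0 ?_).1 hIh
      exact (hch.mono hsub).integrableOn_compact isCompact_Icc
    have heqOn := Measure.eqOn_of_ae_eq hae (hch.mono hsub) continuousOn_const (by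
      rw [Set.Icc_prod_eq, interior_prod_eq, interior_Icc, interior_Icc, closure_prod_eq,
        closure_Ioo (by linarith : -M ≠ 0), closure_Ioo (by linarith : -M ≠ M)])
    have hqin : q ∈ Set.Icc ((-M, -M) : ℝ × ℝ) (0, M) := by
      have := abs_le.1 (by linarith : |q.1| ≤ M)
      have h2 := abs_le.1 (by linarith : |q.2| ≤ M)
      exact ⟨⟨this.1, h2.1⟩, ⟨hq, h2.2⟩⟩
    have h5 := heqOn hqin
    simp only [hh, Pi.zero_apply] at h5
    have h6 := pow_eq_zero_iff (by omega) |>.1 h5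
    have h7 := le_max_left (U q ^ 2 - ε ^ 2) 0
    linarith
  intro q hq
  by_contra hne
  have h1 := key (|U q| / 2) (by positivity) q hq
  have h2 : 0 < |U q| := by positivity
  rw [← sq_abs] at h1
  nlinarith

lemma half_plane_im_le (f : ℂ → ℂ) (hd : DiffContOnCl ℂ f {z | 0 < z.re})
    (hb : ∀ y : ℝ, (f (y * Complex.I)).im = 0)
    (hg : ∀ ε > 0, ∃ M : ℝ, ∀ z : ℂ, 0 < z.re → M < ‖z‖ → |(f z).im| ≤ ε * ‖z‖)
    (z : ℂ) (hz : 0 ≤ z.re) : 0 ≤ (f z).im := by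
  have key : ∀ ε : ℝ, 0 < ε → ‖Complex.exp (Complex.I * f z - ε * z)‖ ≤ 1 := by
    intro ε hε
    refine PhragmenLindelof.right_half_plane_of_bounded_on_real
      (f := fun z => Complex.exp (Complex.I * f z - ε * z)) ?_ ?_ ?_ ?_ hz
    · have h1 : DiffContOnCl ℂ (fun z => Complex.I * f z - ε * z) {z | 0 < z.re} := by
        refine DiffContOnCl.sub ?_ ?_
        · exact hd.const_smul Complex.I
        · exact (Differentiable.diffContOnCl (by fun_prop))
      exact Complex.differentiable_exp.comp_diffContOnCl h1
    · refine ⟨1, by norm_num, 1, ?_⟩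
      obtain ⟨M, hM⟩ := hg 1 one_pos
      refine Asymptotics.IsBigO.of_bound 1 ?_
      rw [Filter.eventually_inf_principal]
      filter_upwards [(tendsto_norm_cobounded_atTop (E := ℂ)).eventually (eventually_gt_atTop M)] with w hw hw0
      have hw0 : 0 < w.re := hw0
      have := hM w hw0 hw
      rw [Complex.norm_exp, one_mul, Real.norm_eq_abs, abs_of_pos (Real.exp_pos _)]
      gcongr
      simp
      nlinarith [neg_le_abs ((f w).im)]
    · obtain ⟨M, hM⟩ := hg ε hε
      refine ⟨1, ?_⟩
      rw [Filter.eventually_map]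
      filter_upwards [eventually_gt_atTop M, eventually_gt_atTop 0] with x hx hx0
      have h1 := hM x (by simpa using hx0) (by simpa [abs_of_pos hx0] using hx)
      rw [Complex.norm_exp]
      rw [Real.exp_le_one_iff]
      simp only [Complex.norm_real, Real.norm_eq_abs, abs_of_pos hx0] at h1
      simp
      nlinarith [neg_le_abs ((f x).im)]
    · intro x
      rw [Complex.norm_exp, Real.exp_le_one_iff]
      simp [hb]
  have h2 : ∀ ε : ℝ, 0 < ε → -(f z).im ≤ ε * z.re := by
    intro ε hε
    have := key ε hε
    rw [Complex.norm_exp, Real.exp_le_one_iff] at this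
    simp at this
    linarith
  by_contra hneg
  push Not at hneg
  have h3 := h2 (-(f z).im / (2 * (z.re + 1))) (by apply div_pos <;> linarith)
  have h4 : -(f z).im / (2 * (z.re + 1)) * z.re ≤ -(f z).im / 2 := by
    rw [div_mul_eq_mul_div, div_le_div_iff₀ (by linarith) (by norm_num)]
    nlinarith
  linarith

lemma half_plane_im_zero (f : ℂ → ℂ) (hd : DiffContOnCl ℂ f {z | 0 < z.re})
    (hb : ∀ y : ℝ, (f (y * Complex.I)).im = 0)
    (hg : ∀ ε > 0, ∃ M : ℝ, ∀ z : ℂ, 0 < z.re → M < ‖z‖ → |(f z).im| ≤ ε * ‖z‖)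
    (z : ℂ) (hz : 0 ≤ z.re) : (f z).im = 0 := by
  apply le_antisymm _ (half_plane_im_le f hd hb hg z hz)
  have := half_plane_im_le (fun z => - f z) hd.neg (by simpa using hb) (by simpa using hg) z hz
  simpa using this
lemma fd_pd1 (F : ℝ → ℝ → ℝ) (R Z : ℝ)
    (h : DifferentiableAt ℝ (fun q : ℝ × ℝ => F q.1 q.2) (R, Z)) :
    HasDerivAt (fun s => F s Z) (pd1 F R Z) R ∧
    fderiv ℝ (fun q : ℝ × ℝ => F q.1 q.2) (R, Z) (1, 0) = pd1 F R Z := by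
  have h1 : HasDerivAt (fun s : ℝ => ((s, Z) : ℝ × ℝ)) (1, 0) R :=
    (hasDerivAt_id R).prodMk (hasDerivAt_const R Z)
  have h2 := h.hasFDerivAt.comp_hasDerivAt R h1
  have h3 : HasDerivAt (fun s => F s Z) _ R := h2
  have : pd1 F R Z = _ := h3.deriv
  rw [this]; exact ⟨h3, rfl⟩

lemma fd_pd2 (F : ℝ → ℝ → ℝ) (R Z : ℝ)
    (h : DifferentiableAt ℝ (fun q : ℝ × ℝ => F q.1 q.2) (R, Z)) :
    HasDerivAt (fun s => F R s) (pd2 F R Z) Z ∧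
    fderiv ℝ (fun q : ℝ × ℝ => F q.1 q.2) (R, Z) (0, 1) = pd2 F R Z := by
  have h1 : HasDerivAt (fun s : ℝ => ((R, s) : ℝ × ℝ)) (0, 1) Z :=
    (hasDerivAt_const Z R).prodMk (hasDerivAt_id Z)
  have h2 := h.hasFDerivAt.comp_hasDerivAt Z h1
  have h3 : HasDerivAt (fun s => F R s) _ Z := h2
  have : pd2 F R Z = _ := h3.deriv
  rw [this]; exact ⟨h3, rfl⟩

lemma halfplane_nhds (q : ℝ × ℝ) (hq : q.1 < 0) : {q : ℝ × ℝ | q.1 < 0} ∈ nhds q :=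
  (isOpen_lt continuous_fst continuous_const).mem_nhds hq

lemma halfplane_nhds' (q : ℝ × ℝ) (hq : q.1 < 0) : {q : ℝ × ℝ | q.1 ≤ 0} ∈ nhds q :=
  mem_of_superset (halfplane_nhds q hq) fun x (h : x.1 < 0) => (le_of_lt h : x.1 ≤ 0)

lemma halfplane_ud : UniqueDiffOn ℝ {q : ℝ × ℝ | q.1 ≤ 0} := by
  apply uniqueDiffOn_convex
  · exact convex_halfSpace_le (f := fun q : ℝ × ℝ => q.1) ⟨fun _ _ => rfl, fun _ _ => rfl⟩ 0
  · exact ⟨(-1, 0), mem_interior_iff_mem_nhds.2 (halfplane_nhds' _ (by norm_num))⟩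

lemma psi_pack (Ψ : ℝ → ℝ → ℝ)
    (hreg : ContDiffOn ℝ 2 (fun q : ℝ × ℝ => Ψ q.1 q.2) {q : ℝ × ℝ | q.1 ≤ 0}) :
    ∃ A B : ℝ × ℝ → ℝ, ContinuousOn A {q | q.1 ≤ 0} ∧ ContinuousOn B {q | q.1 ≤ 0} ∧
      (∀ Z, B (0, Z) = pd2 Ψ 0 Z) ∧
      (∀ q : ℝ × ℝ, q.1 < 0 → A q = pd1 Ψ q.1 q.2 ∧ B q = pd2 Ψ q.1 q.2 ∧
        DifferentiableAt ℝ A q ∧ DifferentiableAt ℝ B q ∧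
        DifferentiableAt ℝ (fun q : ℝ × ℝ => pd1 Ψ q.1 q.2) q ∧
        DifferentiableAt ℝ (fun q : ℝ × ℝ => pd2 Ψ q.1 q.2) q ∧
        fderiv ℝ A q (0, 1) = fderiv ℝ B q (1, 0) ∧
        fderiv ℝ A q (1, 0) = pd1 (pd1 Ψ) q.1 q.2 ∧
        fderiv ℝ B q (0, 1) = pd2 (pd2 Ψ) q.1 q.2) := by
  set D : Set (ℝ × ℝ) := {q : ℝ × ℝ | q.1 ≤ 0} with hD
  set f : ℝ × ℝ → ℝ := fun q : ℝ × ℝ => Ψ q.1 q.2 with hf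
  have h1 : ContDiffOn ℝ 1 (fderivWithin ℝ f D) D :=
    hreg.fderivWithin halfplane_ud (by norm_num)
  have hA : ContDiffOn ℝ 1 (fun q => fderivWithin ℝ f D q (1, 0)) D :=
    h1.clm_apply contDiffOn_const
  have hB : ContDiffOn ℝ 1 (fun q => fderivWithin ℝ f D q (0, 1)) D :=
    h1.clm_apply contDiffOn_const
  have hdf : ∀ q : ℝ × ℝ, q.1 < 0 → DifferentiableAt ℝ f q := fun q hq =>
    (hreg.contDiffAt (halfplane_nhds' q hq)).differentiableAt (by norm_num)
  have eA : ∀ q : ℝ × ℝ, q.1 < 0 → fderivWithin ℝ f D q (1, 0) = pd1 Ψ q.1 q.2 := fun q hq => by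
    rw [fderivWithin_of_mem_nhds (halfplane_nhds' q hq)]
    exact (fd_pd1 Ψ q.1 q.2 (hdf q hq)).2
  have eB : ∀ q : ℝ × ℝ, q.1 < 0 → fderivWithin ℝ f D q (0, 1) = pd2 Ψ q.1 q.2 := fun q hq => by
    rw [fderivWithin_of_mem_nhds (halfplane_nhds' q hq)]
    exact (fd_pd2 Ψ q.1 q.2 (hdf q hq)).2
  refine ⟨fun q => fderivWithin ℝ f D q (1, 0), fun q => fderivWithin ℝ f D q (0, 1),
    hA.continuousOn, hB.continuousOn, ?_, ?_⟩
  · intro Z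
    have h2 : HasFDerivWithinAt f (fderivWithin ℝ f D (0, Z)) D (0, Z) :=
      (hreg.differentiableOn (by norm_num) (0, Z) (by simp [hD])).hasFDerivWithinAt
    have h3 : HasDerivAt (fun s : ℝ => (((0 : ℝ), s) : ℝ × ℝ)) (0, 1) Z :=
      (hasDerivAt_const Z (0 : ℝ)).prodMk (hasDerivAt_id Z)
    have h4 := h2.comp_hasDerivWithinAt Z (h3.hasDerivWithinAt (s := Set.univ))
      (fun x _ => by simp [hD])
    have h5 := (h4.hasDerivAt univ_mem).deriv
    exact h5.symm
  · intro q hq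
    have nq := halfplane_nhds q hq
    have dA : DifferentiableAt ℝ (fun q => fderivWithin ℝ f D q (1, 0)) q :=
      (hA.contDiffAt (halfplane_nhds' q hq)).differentiableAt (by norm_num)
    have dB : DifferentiableAt ℝ (fun q => fderivWithin ℝ f D q (0, 1)) q :=
      (hB.contDiffAt (halfplane_nhds' q hq)).differentiableAt (by norm_num)
    have evA : (fun q => fderivWithin ℝ f D q (1, 0)) =ᶠ[nhds q] fun q => pd1 Ψ q.1 q.2 := by
      filter_upwards [nq] with x hx using eA x hx
    have evB : (fun q => fderivWithin ℝ f D q (0, 1)) =ᶠ[nhds q] fun q => pd2 Ψ q.1 q.2 := by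
      filter_upwards [nq] with x hx using eB x hx
    have dA' := evA.differentiableAt_iff.1 dA
    have dB' := evB.differentiableAt_iff.1 dB
    refine ⟨eA q hq, eB q hq, dA, dB, dA', dB', ?_, ?_, ?_⟩
    · have hs : IsSymmSndFDerivAt ℝ f q :=
        (hreg.contDiffAt (halfplane_nhds' q hq)).isSymmSndFDerivAt (by simp)
      have ev : fderivWithin ℝ f D =ᶠ[nhds q] fderiv ℝ f := by
        filter_upwards [nq] with x hx using fderivWithin_of_mem_nhds (halfplane_nhds' x hx)
      have dd : DifferentiableAt ℝ (fderiv ℝ f) q :=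
        ev.differentiableAt_iff.1
          ((h1.contDiffAt (halfplane_nhds' q hq)).differentiableAt (by norm_num))
      have e1 : (fun q => fderivWithin ℝ f D q (1, 0)) =ᶠ[nhds q] fun q => fderiv ℝ f q (1, 0) := by
        filter_upwards [ev] with x hx using by rw [hx]
      have e2 : (fun q => fderivWithin ℝ f D q (0, 1)) =ᶠ[nhds q] fun q => fderiv ℝ f q (0, 1) := by
        filter_upwards [ev] with x hx using by rw [hx]
      rw [e1.fderiv_eq, e2.fderiv_eq]
      have e3 := (dd.hasFDerivAt.clm_apply (hasFDerivAt_const ((1, 0) : ℝ × ℝ) q)).fderiv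
      have e4 := (dd.hasFDerivAt.clm_apply (hasFDerivAt_const ((0, 1) : ℝ × ℝ) q)).fderiv
      rw [e3, e4]
      simpa using hs (0, 1) (1, 0)
    · rw [evA.fderiv_eq]
      exact (fd_pd1 (pd1 Ψ) q.1 q.2 dA').2
    · rw [evB.fderiv_eq]
      exact (fd_pd2 (pd2 Ψ) q.1 q.2 dB').2

lemma harm (Ψ : ℝ → ℝ → ℝ)
    (hreg : ContDiffOn ℝ 2 (fun q : ℝ × ℝ => Ψ q.1 q.2) {q : ℝ × ℝ | q.1 ≤ 0})
    (hgrad : ∀ ε > 0, ∃ M : ℝ, ∀ R ≤ (0 : ℝ), ∀ Z : ℝ,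
      M < Real.sqrt (R ^ 2 + Z ^ 2) →
      Real.sqrt ((pd1 Ψ R Z) ^ 2 + (pd2 Ψ R Z) ^ 2)
        ≤ ε * Real.sqrt (R ^ 2 + Z ^ 2))
    (hbc : ∀ Z : ℝ, pd2 Ψ 0 Z = 0) (c : ℝ)
    (hlap : ∀ R < 0, ∀ Z, pd1 (pd1 Ψ) R Z + pd2 (pd2 Ψ) R Z = c) :
    c = 0 ∧ ∃ d, ∀ R < 0, ∀ Z, pd1 Ψ R Z = d ∧ pd2 Ψ R Z = 0 := by
  obtain ⟨A, B, cA, cB, bB, hAB⟩ := psi_pack Ψ hreg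
  -- the map ℂ → ℝ × ℝ
  set L : ℂ →L[ℝ] ℝ × ℝ := (-Complex.reCLM).prod Complex.imCLM with hL
  have hLv : ∀ z : ℂ, L z = (-z.re, z.im) := fun z => rfl
  set f : ℂ → ℂ := fun z => ((A (L z) + c * z.re : ℝ) : ℂ) + (B (L z) : ℂ) * Complex.I with hf
  have fim : ∀ z, (f z).im = B (L z) := by intro z; simp [hf]
  have hd : DiffContOnCl ℂ f {z | 0 < z.re} := by
    constructor
    · intro z hz
      have hz : 0 < z.re := hz
      apply DifferentiableAt.differentiableWithinAt
      obtain ⟨-, -, dA, dB, -, -, hmix, hA1, hB2⟩ := hAB (L z) (by simp [hLv, hz])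
      have hl := hlap (-z.re) (by linarith) z.im
      rw [hLv] at hA1 hB2
      simp only at hA1 hB2
      rw [← hA1, ← hB2, ← hLv] at hl
      have d1 : HasFDerivAt (fun z : ℂ => A (L z)) ((fderiv ℝ A (L z)).comp L) z :=
        dA.hasFDerivAt.comp z L.hasFDerivAt
      have d2 : HasFDerivAt (fun z : ℂ => B (L z)) ((fderiv ℝ B (L z)).comp L) z :=
        dB.hasFDerivAt.comp z L.hasFDerivAt
      have d3 : HasFDerivAt (fun z : ℂ => A (L z) + c * z.re)
          ((fderiv ℝ A (L z)).comp L + c • Complex.reCLM) z :=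
        d1.add (Complex.reCLM.hasFDerivAt.const_mul c)
      have d4 : HasFDerivAt f (Complex.ofRealCLM.comp ((fderiv ℝ A (L z)).comp L + c • Complex.reCLM)
          + (Complex.ofRealCLM.comp ((fderiv ℝ B (L z)).comp L)).smulRight Complex.I) z :=
        (Complex.ofRealCLM.hasFDerivAt.comp z d3).add
          ((Complex.ofRealCLM.hasFDerivAt.comp z d2).mul_const' Complex.I)
      rw [differentiableAt_complex_iff_differentiableAt_real]
      refine ⟨d4.differentiableAt, ?_⟩
      rw [d4.fderiv]
      have l1 : L 1 = -(1, 0) := by simp [hLv]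
      have l2 : L Complex.I = (0, 1) := by simp [hLv]
      have hneg : ∀ T : ℝ × ℝ →L[ℝ] ℝ, T (-1, 0) = - T (1, 0) := by
        intro T; rw [← map_neg]; simp
      apply Complex.ext
      · simp [l1, l2, hmix, hneg]
      · simp [l1, l2, hneg]
        linarith
    · have hcl : closure {z : ℂ | 0 < z.re} ⊆ {z | 0 ≤ z.re} :=
        closure_minimal (fun z (hz : 0 < z.re) => (le_of_lt hz : 0 ≤ z.re)) (isClosed_le continuous_const Complex.continuous_re)
      refine ContinuousOn.mono ?_ hcl
      have hmap : Set.MapsTo L {z : ℂ | 0 ≤ z.re} {q | q.1 ≤ 0} := by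
        intro z hz; simpa [hLv] using hz
      have c1 := cA.comp L.continuous.continuousOn hmap
      have c2 := cB.comp L.continuous.continuousOn hmap
      have c3 : ContinuousOn (fun z : ℂ => c * z.re) {z : ℂ | 0 ≤ z.re} := by fun_prop
      refine ContinuousOn.add (Complex.continuous_ofReal.comp_continuousOn (c1.add c3)) ?_
      exact (Complex.continuous_ofReal.comp_continuousOn c2).mul continuousOn_const
  have him := half_plane_im_zero f hd
    (by
      intro y
      rw [fim, hLv]
      simp [bB, hbc])
    (by
      intro ε hε
      obtain ⟨M, hM⟩ := hgrad ε hε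
      refine ⟨M, fun z hz hMz => ?_⟩
      have hn : Real.sqrt ((-z.re) ^ 2 + z.im ^ 2) = ‖z‖ := by
        rw [Complex.norm_def, Complex.normSq_apply]; congr 1; ring
      have := hM (-z.re) (by linarith) z.im (by rw [hn]; exact hMz)
      rw [hn] at this
      rw [fim, (hAB (L z) (by simp [hLv, hz])).2.1]
      refine le_trans ?_ this
      rw [hLv]
      apply Real.abs_le_sqrt
      nlinarith [sq_nonneg (pd1 Ψ (-z.re) z.im)])
  have hB0 : ∀ R < 0, ∀ Z, pd2 Ψ R Z = 0 := by
    intro R hR Z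
    have h1 := him ⟨-R, Z⟩ (by simp; linarith)
    rw [fim, hLv] at h1
    simp only [neg_neg] at h1
    rw [← h1, (hAB (R, Z) hR).2.1]
  have hBev : ∀ q : ℝ × ℝ, q.1 < 0 → fderiv ℝ B q = 0 := by
    intro q hq
    have : B =ᶠ[nhds q] fun _ => 0 := by
      filter_upwards [halfplane_nhds q hq] with x hx
      rw [(hAB x hx).2.1, hB0 x.1 hx x.2]
    rw [this.fderiv_eq]; simp
  have hAfd : ∀ q : ℝ × ℝ, q.1 < 0 → fderiv ℝ (fun q => A q - c * q.1) q = 0 := by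
    intro q hq
    obtain ⟨-, -, dA, dB, -, -, hmix, hA1, hB2⟩ := hAB q hq
    have hl := hlap q.1 hq q.2
    rw [← hA1, ← hB2, hBev q hq] at hl
    rw [hBev q hq] at hmix
    have d1 : HasFDerivAt (fun q : ℝ × ℝ => A q - c * q.1)
      (fderiv ℝ A q - c • ContinuousLinearMap.fst ℝ ℝ ℝ) q :=
      dA.hasFDerivAt.sub ((ContinuousLinearMap.fst ℝ ℝ ℝ).hasFDerivAt.const_mul c)
    rw [d1.fderiv]
    ext
    · simp at hl ⊢; linarith
    · simp at hmix ⊢; linarith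
  have hconst : ∀ R < 0, ∀ Z, A (R, Z) - c * R = A (-1, 0) + c := by
    intro R hR Z
    have hconv : Convex ℝ {q : ℝ × ℝ | q.1 < 0} :=
      convex_halfSpace_lt (f := fun q : ℝ × ℝ => q.1) ⟨fun _ _ => rfl, fun _ _ => rfl⟩ 0
    have := (isOpen_lt continuous_fst continuous_const).is_const_of_fderiv_eq_zero (𝕜 := ℝ)
      (f := fun q : ℝ × ℝ => A q - c * q.1) hconv.isPreconnected
      (fun q hq => ((hAB q hq).2.2.1.sub (by fun_prop)).differentiableWithinAt)
      (fun q hq => hAfd q hq) (x := (R, Z)) (y := (-1, 0)) hR (by simp)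
    simpa using this
  set e := A (-1, 0) + c with he
  have hA' : ∀ R < 0, ∀ Z, pd1 Ψ R Z = c * R + e := by
    intro R hR Z
    rw [← (hAB (R, Z) hR).1]
    linarith [hconst R hR Z]
  have hc : c = 0 := by
    by_contra hne
    obtain ⟨M, hM⟩ := hgrad (|c| / 2) (by positivity)
    set X : ℝ := |M| + 2 * |e| / |c| + 1 with hX
    have hXpos : 0 < X := by positivity
    have hs : Real.sqrt ((-X) ^ 2 + 0 ^ 2) = X := by
      rw [show (-X) ^ 2 + 0 ^ 2 = X ^ 2 by ring]; exact Real.sqrt_sq hXpos.le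
    have h1 := hM (-X) (by linarith) 0 (by
      rw [hs]
      have : 0 ≤ 2 * |e| / |c| := by positivity
      linarith [le_abs_self M])
    rw [hs, hA' _ (by linarith), hB0 _ (by linarith)] at h1
    rw [show (c * -X + e) ^ 2 + 0 ^ 2 = (c * -X + e) ^ 2 by ring, Real.sqrt_sq_eq_abs] at h1
    have h2 : |c| * X - |e| ≤ |c * -X + e| := by
      have h3 := abs_sub_abs_le_abs_sub (c * -X) (-e)
      rw [abs_mul, abs_neg, abs_neg, abs_of_pos hXpos, sub_neg_eq_add] at h3
      exact h3
    have hcpos : 0 < |c| := by positivity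
    have h4 : |c| * X = |c| * |M| + 2 * |e| + |c| := by
      rw [hX]; field_simp
    nlinarith [abs_nonneg M]
  refine ⟨hc, e, fun R hR Z => ⟨?_, hB0 R hR Z⟩⟩
  rw [hA' R hR Z, hc]; ring

def CylC (T δ r z t : ℝ) : Prop :=
  1 - δ < r ∧ r < 1 ∧ -δ < z ∧ z < δ ∧ T - δ < t ∧ t < T

def RepF (T δ γ : ℝ) (N : ℕ) (e : ℝ) (F : ℕ → ℝ → ℝ → ℝ) (f : ℝ → ℝ → ℝ → ℝ) : Prop :=
  ∀ r z t, CylC T δ r z t → f r z t = (T - t) ^ e *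
    ∑ k ∈ Finset.range (N + 1), (T - t) ^ ((k : ℝ) * γ) *
      F k ((r - 1) * (T - t) ^ (-γ)) (z * (T - t) ^ (-γ))

lemma rep_pdr {T δ γ : ℝ} {N : ℕ} {e : ℝ} {F : ℕ → ℝ → ℝ → ℝ} {f : ℝ → ℝ → ℝ → ℝ}
    (h : RepF T δ γ N e F f)
    (hd : ∀ k ≤ N, ∀ R < 0, ∀ Z, DifferentiableAt ℝ (fun q : ℝ × ℝ => F k q.1 q.2) (R, Z)) :
    RepF T δ γ N (e - γ) (fun k => pd1 (F k)) (pdr f) := by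
  intro r z t hC
  obtain ⟨h1, h2, h3, h4, h5, h6⟩ := hC
  have hs : 0 < T - t := by linarith
  have hR : (r - 1) * (T - t) ^ (-γ) < 0 :=
    mul_neg_of_neg_of_pos (by linarith) (Real.rpow_pos_of_pos hs _)
  have ev : (fun s => f s z t) =ᶠ[nhds r] fun s => (T - t) ^ e *
      ∑ k ∈ Finset.range (N + 1), (T - t) ^ ((k : ℝ) * γ) *
      F k ((s - 1) * (T - t) ^ (-γ)) (z * (T - t) ^ (-γ)) := by
    filter_upwards [Ioo_mem_nhds h1 h2] with s hs'
    exact h s z t ⟨hs'.1, hs'.2, h3, h4, h5, h6⟩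
  have hder : HasDerivAt (fun s => (T - t) ^ e *
      ∑ k ∈ Finset.range (N + 1), (T - t) ^ ((k : ℝ) * γ) *
      F k ((s - 1) * (T - t) ^ (-γ)) (z * (T - t) ^ (-γ)))
      ((T - t) ^ e * ∑ k ∈ Finset.range (N + 1), (T - t) ^ ((k : ℝ) * γ) *
      (pd1 (F k) ((r - 1) * (T - t) ^ (-γ)) (z * (T - t) ^ (-γ)) * (T - t) ^ (-γ))) r := by
    apply HasDerivAt.const_mul
    apply HasDerivAt.fun_sum
    intro k hk
    apply HasDerivAt.const_mul
    have hk' : k ≤ N := by simpa [Nat.lt_succ_iff] using hk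
    have d1 := (fd_pd1 (F k) _ (z * (T - t) ^ (-γ)) (hd k hk' _ hR _)).1
    have d2 : HasDerivAt (fun s : ℝ => (s - 1) * (T - t) ^ (-γ)) ((T - t) ^ (-γ)) r := by
      simpa using ((hasDerivAt_id r).sub_const 1).mul_const ((T - t) ^ (-γ))
    exact d1.comp r d2
  have : pdr f r z t = _ := (hder.congr_of_eventuallyEq ev).deriv
  rw [this, sub_eq_add_neg e γ, Real.rpow_add hs, Finset.mul_sum, Finset.mul_sum]
  exact Finset.sum_congr rfl fun k _ => by ring

lemma rep_pdz {T δ γ : ℝ} {N : ℕ} {e : ℝ} {F : ℕ → ℝ → ℝ → ℝ} {f : ℝ → ℝ → ℝ → ℝ}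
    (h : RepF T δ γ N e F f)
    (hd : ∀ k ≤ N, ∀ R < 0, ∀ Z, DifferentiableAt ℝ (fun q : ℝ × ℝ => F k q.1 q.2) (R, Z)) :
    RepF T δ γ N (e - γ) (fun k => pd2 (F k)) (pdz f) := by
  intro r z t hC
  obtain ⟨h1, h2, h3, h4, h5, h6⟩ := hC
  have hs : 0 < T - t := by linarith
  have hR : (r - 1) * (T - t) ^ (-γ) < 0 :=
    mul_neg_of_neg_of_pos (by linarith) (Real.rpow_pos_of_pos hs _)
  have ev : (fun s => f r s t) =ᶠ[nhds z] fun s => (T - t) ^ e *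
      ∑ k ∈ Finset.range (N + 1), (T - t) ^ ((k : ℝ) * γ) *
      F k ((r - 1) * (T - t) ^ (-γ)) (s * (T - t) ^ (-γ)) := by
    filter_upwards [Ioo_mem_nhds h3 h4] with s hs'
    exact h r s t ⟨h1, h2, hs'.1, hs'.2, h5, h6⟩
  have hder : HasDerivAt (fun s => (T - t) ^ e *
      ∑ k ∈ Finset.range (N + 1), (T - t) ^ ((k : ℝ) * γ) *
      F k ((r - 1) * (T - t) ^ (-γ)) (s * (T - t) ^ (-γ)))
      ((T - t) ^ e * ∑ k ∈ Finset.range (N + 1), (T - t) ^ ((k : ℝ) * γ) *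
      (pd2 (F k) ((r - 1) * (T - t) ^ (-γ)) (z * (T - t) ^ (-γ)) * (T - t) ^ (-γ))) z := by
    apply HasDerivAt.const_mul
    apply HasDerivAt.fun_sum
    intro k hk
    apply HasDerivAt.const_mul
    have hk' : k ≤ N := by simpa [Nat.lt_succ_iff] using hk
    have d1 := (fd_pd2 (F k) _ (z * (T - t) ^ (-γ)) (hd k hk' _ hR _)).1
    have d2 : HasDerivAt (fun s : ℝ => s * (T - t) ^ (-γ)) ((T - t) ^ (-γ)) z := by
      simpa using (hasDerivAt_id z).mul_const ((T - t) ^ (-γ))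
    exact d1.comp z d2
  have : pdz f r z t = _ := (hder.congr_of_eventuallyEq ev).deriv
  rw [this, sub_eq_add_neg e γ, Real.rpow_add hs, Finset.mul_sum, Finset.mul_sum]
  exact Finset.sum_congr rfl fun k _ => by ring

lemma hasDerivAt_Tpow (T t p : ℝ) (hs : 0 < T - t) :
    HasDerivAt (fun τ => (T - τ) ^ p) (-p * ((T - t) ^ p / (T - t))) t := by
  have h1 : HasDerivAt (fun τ => T - τ) (-1) t := by
    simpa using (hasDerivAt_id t).const_sub T
  have h2 := h1.rpow_const (p := p) (Or.inl hs.ne')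
  rw [Real.rpow_sub_one hs.ne'] at h2
  convert h2 using 1
  ring

lemma rep_pdt {T δ γ : ℝ} {N : ℕ} {e : ℝ} {F : ℕ → ℝ → ℝ → ℝ} {f : ℝ → ℝ → ℝ → ℝ}
    (h : RepF T δ γ N e F f)
    (hd : ∀ k ≤ N, ∀ R < 0, ∀ Z, DifferentiableAt ℝ (fun q : ℝ × ℝ => F k q.1 q.2) (R, Z)) :
    RepF T δ γ N (e - 1) (fun k R Z => (-e - k * γ) * F k R Z +
      γ * (R * pd1 (F k) R Z + Z * pd2 (F k) R Z)) (pdt f) := by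
  intro r z t hC
  obtain ⟨h1, h2, h3, h4, h5, h6⟩ := hC
  have hs : 0 < T - t := by linarith
  have hR : (r - 1) * (T - t) ^ (-γ) < 0 :=
    mul_neg_of_neg_of_pos (by linarith) (Real.rpow_pos_of_pos hs _)
  have ev : (fun s => f r z s) =ᶠ[nhds t] fun s => (T - s) ^ e *
      ∑ k ∈ Finset.range (N + 1), (T - s) ^ ((k : ℝ) * γ) *
      F k ((r - 1) * (T - s) ^ (-γ)) (z * (T - s) ^ (-γ)) := by
    filter_upwards [Ioo_mem_nhds h5 h6] with s hs'
    exact h r z s ⟨h1, h2, h3, h4, hs'.1, hs'.2⟩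
  have hsum : HasDerivAt (fun s =>
      ∑ k ∈ Finset.range (N + 1), (T - s) ^ ((k : ℝ) * γ) *
      F k ((r - 1) * (T - s) ^ (-γ)) (z * (T - s) ^ (-γ)))
      (∑ k ∈ Finset.range (N + 1), (T - t) ^ ((k : ℝ) * γ) / (T - t) *
      ((- (k * γ)) * F k ((r - 1) * (T - t) ^ (-γ)) (z * (T - t) ^ (-γ)) +
      γ * (((r - 1) * (T - t) ^ (-γ)) *
        pd1 (F k) ((r - 1) * (T - t) ^ (-γ)) (z * (T - t) ^ (-γ)) +
        (z * (T - t) ^ (-γ)) *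
        pd2 (F k) ((r - 1) * (T - t) ^ (-γ)) (z * (T - t) ^ (-γ))))) t := by
    apply HasDerivAt.fun_sum
    intro k hk
    have hk' : k ≤ N := by simpa [Nat.lt_succ_iff] using hk
    have hdk := hd k hk' _ hR (z * (T - t) ^ (-γ))
    have d0 := hasDerivAt_Tpow T t (-γ) hs
    have d1 : HasDerivAt (fun s : ℝ => (((r - 1) * (T - s) ^ (-γ), z * (T - s) ^ (-γ)) : ℝ × ℝ))
      ((r - 1) * (-(-γ) * ((T - t) ^ (-γ) / (T - t))),
        z * (-(-γ) * ((T - t) ^ (-γ) / (T - t)))) t :=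
      (d0.const_mul (r - 1)).prodMk (d0.const_mul z)
    have d2 := hdk.hasFDerivAt.comp_hasDerivAt t d1
    have d3 := (hasDerivAt_Tpow T t (k * γ) hs).mul d2
    refine d3.congr_deriv ?_
    have hlin : ∀ a b : ℝ, fderiv ℝ (fun q : ℝ × ℝ => F k q.1 q.2)
        ((r - 1) * (T - t) ^ (-γ), z * (T - t) ^ (-γ)) (a, b) =
        a * pd1 (F k) ((r - 1) * (T - t) ^ (-γ)) (z * (T - t) ^ (-γ)) +
        b * pd2 (F k) ((r - 1) * (T - t) ^ (-γ)) (z * (T - t) ^ (-γ)) := by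
      intro a b
      rw [← (fd_pd1 (F k) _ _ hdk).2, ← (fd_pd2 (F k) _ _ hdk).2,
        show ((a, b) : ℝ × ℝ) = a • (1, 0) + b • (0, 1) by simp, map_add, map_smul, map_smul]
      simp
    rw [hlin]
    simp only [Function.comp_apply]
    field_simp
  have hder := (hasDerivAt_Tpow T t e hs).mul hsum
  have : pdt f r z t = _ := (hder.congr_of_eventuallyEq ev).deriv
  rw [this, Real.rpow_sub_one hs.ne', Finset.mul_sum, Finset.mul_sum, Finset.mul_sum,
    ← Finset.sum_add_distrib]
  refine Finset.sum_congr rfl fun k _ => ?_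
  field_simp
  ring

lemma scale_exists {T δ γ : ℝ} (hδ : 0 < δ) (hγ : 0 < γ) (R Z : ℝ) (hR : R < 0) :
    ∃ x0 > 0, ∀ x, 0 < x → x < x0 →
      ∃ s, 0 < s ∧ s ^ γ = x ∧ CylC T δ (1 + x * R) (x * Z) (T - s) := by
  have hδγ : 0 < δ ^ γ := Real.rpow_pos_of_pos hδ _
  have hZ : 0 < |Z| + 1 := by positivity
  refine ⟨min (δ ^ γ) (min (δ / (-R)) (δ / (|Z| + 1))), ?_, ?_⟩
  · have : 0 < δ / (-R) := div_pos hδ (by linarith)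
    positivity
  · intro x hx hx0
    have a1 := lt_of_lt_of_le hx0 (min_le_left _ _)
    have a2 := lt_of_lt_of_le hx0 ((min_le_right _ _).trans (min_le_left _ _))
    have a3 := lt_of_lt_of_le hx0 ((min_le_right _ _).trans (min_le_right _ _))
    rw [lt_div_iff₀ (by linarith)] at a2
    rw [lt_div_iff₀ hZ] at a3
    have hsg : (x ^ (1 / γ)) ^ γ = x := by
      rw [← Real.rpow_mul hx.le, one_div, inv_mul_cancel₀ hγ.ne', Real.rpow_one]
    have hspos : 0 < x ^ (1 / γ) := Real.rpow_pos_of_pos hx _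
    have hsd : x ^ (1 / γ) < δ := by
      rw [← hsg] at a1
      exact (Real.rpow_lt_rpow_iff hspos.le hδ.le hγ).1 a1
    have b1 : x * Z ≤ x * |Z| := by gcongr; exact le_abs_self Z
    have b2 : x * (-Z) ≤ x * |Z| := by gcongr; exact neg_le_abs Z
    refine ⟨x ^ (1 / γ), hspos, hsg, ?_, ?_, ?_, ?_, ?_, ?_⟩ <;> nlinarith

lemma rep_eval {T δ γ : ℝ} {N : ℕ} {e : ℝ} {F : ℕ → ℝ → ℝ → ℝ} {f : ℝ → ℝ → ℝ → ℝ}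
    (h : RepF T δ γ N e F f) {x s R Z : ℝ} (hx : 0 < x) (hs : 0 < s) (hsx : s ^ γ = x)
    (hC : CylC T δ (1 + x * R) (x * Z) (T - s)) :
    f (1 + x * R) (x * Z) (T - s) = s ^ e * ∑ k ∈ Finset.range (N + 1), x ^ k * F k R Z := by
  rw [h _ _ _ hC]
  have e1 : T - (T - s) = s := by ring
  rw [e1, Real.rpow_neg hs.le, hsx]
  congr 1
  refine Finset.sum_congr rfl fun k _ => ?_
  rw [mul_comm (k : ℝ) γ, Real.rpow_mul hs.le, hsx, Real.rpow_natCast]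
  congr 2 <;> field_simp
  ring

lemma factor_sum (N k : ℕ) (c : ℕ → ℝ) (h : ∀ l < k, c l = 0) :
    ∃ Q : ℝ → ℝ, Continuous Q ∧ Q 0 = (if k ≤ N then c k else 0) ∧
      ∀ x, ∑ l ∈ Finset.range (N + 1), x ^ l * c l = x ^ k * Q x := by
  refine ⟨fun x => ∑ l ∈ Finset.range (N + 1), if k ≤ l then x ^ (l - k) * c l else 0, ?_, ?_, ?_⟩
  · refine continuous_finsetSum _ fun l _ => ?_
    split_ifs <;> fun_prop
  · have : ∀ l ∈ Finset.range (N + 1), (if k ≤ l then (0 : ℝ) ^ (l - k) * c l else 0)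
        = if k = l then c l else 0 := by
      intro l _
      rcases lt_trichotomy k l with hl | hl | hl
      · rw [if_pos hl.le, if_neg hl.ne, zero_pow (by omega), zero_mul]
      · simp [hl]
      · rw [if_neg (by omega), if_neg (by omega)]
    simp only
    rw [Finset.sum_congr rfl this, Finset.sum_ite_eq]
    simp [Nat.lt_succ_iff]
  · intro x
    rw [Finset.mul_sum]
    refine Finset.sum_congr rfl fun l _ => ?_
    split_ifs with hl
    · rw [← mul_assoc, ← pow_add]; congr 2; omega
    · rw [h l (by omega)]; simp

lemma limit_zero {x0 : ℝ} (hx0 : 0 < x0) (g : ℝ → ℝ) (hg : Continuous g)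
    (h : ∀ x, 0 < x → x < x0 → g x = 0) : g 0 = 0 := by
  have h1 : Tendsto g (nhdsWithin 0 (Set.Ioi 0)) (nhds (g 0)) := hg.continuousWithinAt
  have h2 : Tendsto g (nhdsWithin 0 (Set.Ioi 0)) (nhds 0) := by
    refine tendsto_const_nhds.congr' ?_
    filter_upwards [Ioo_mem_nhdsGT hx0] with x hx
    exact (h x hx.1 hx.2).symm
  exact tendsto_nhds_unique h1 h2

lemma family_zero {T δ γ : ℝ} (hδ : 0 < δ) (hγ : 0 < γ) {N : ℕ} {e κ : ℝ}
    {F Ψ : ℕ → ℝ → ℝ → ℝ} {f ψ1 : ℝ → ℝ → ℝ → ℝ}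
    (hf : RepF T δ γ N e F f) (hψ : RepF T δ γ N (-1 + 2 * γ) Ψ ψ1)
    (hFreg : ∀ k ≤ N, ContDiffOn ℝ 1 (fun q : ℝ × ℝ => F k q.1 q.2) {q : ℝ × ℝ | q.1 ≤ 0})
    (hΨreg : ∀ k ≤ N, ContDiffOn ℝ 2 (fun q : ℝ × ℝ => Ψ k q.1 q.2) {q : ℝ × ℝ | q.1 ≤ 0})
    (heq : ∀ r z t : ℝ, CylC T δ r z t →
      pdt f r z t + (-(r * pdz ψ1 r z t)) * pdr f r z t
        + (2 * ψ1 r z t + r * pdr ψ1 r z t) * pdz f r z t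
        = κ * f r z t * pdz ψ1 r z t)
    (hdecay : ∀ k ≤ N, ∀ ε > 0, ∃ M : ℝ, ∀ R ≤ (0 : ℝ), ∀ Z : ℝ,
      M < Real.sqrt (R ^ 2 + Z ^ 2) → |F k R Z| < ε)
    (hbc : ∀ k ≤ N, ∀ Z : ℝ, pd2 (Ψ k) 0 Z = 0) :
    ∀ k ≤ N, ∀ R ≤ 0, ∀ Z, F k R Z = 0 := by
  have dF : ∀ k ≤ N, ∀ R < 0, ∀ Z,
      DifferentiableAt ℝ (fun q : ℝ × ℝ => F k q.1 q.2) (R, Z) := fun k hk R hR Z =>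
    ((hFreg k hk).contDiffAt (halfplane_nhds' (R, Z) hR)).differentiableAt (by norm_num)
  have dΨ : ∀ k ≤ N, ∀ R < 0, ∀ Z,
      DifferentiableAt ℝ (fun q : ℝ × ℝ => Ψ k q.1 q.2) (R, Z) := fun k hk R hR Z =>
    ((hΨreg k hk).contDiffAt (halfplane_nhds' (R, Z) hR)).differentiableAt (by norm_num)
  obtain ⟨A, B, cA, cB, bB, hAB⟩ := psi_pack (Ψ 0) (hΨreg 0 (Nat.zero_le _))
  intro k
  induction k using Nat.strong_induction_on with
  | _ k ih =>
  intro hk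
  have ih1 : ∀ l < k, ∀ R < 0, ∀ Z, F l R Z = 0 ∧ pd1 (F l) R Z = 0 ∧ pd2 (F l) R Z = 0 := by
    intro l hl R hR Z
    have h0 := ih l hl (by omega)
    refine ⟨h0 R hR.le Z, ?_, ?_⟩
    · have : (fun s => F l s Z) =ᶠ[nhds R] fun _ => 0 := by
        filter_upwards [Iio_mem_nhds hR] with s hs using h0 s (le_of_lt hs) Z
      simp only [pd1]; rw [this.deriv_eq]; simp
    · have : (fun s => F l R s) = fun _ => 0 := by
        funext s; exact h0 R hR.le s
      simp only [pd2]; rw [this]; simp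
  have hpde : ∀ R < 0, ∀ Z, ((-e - k * γ) * F k R Z +
      γ * (R * pd1 (F k) R Z + Z * pd2 (F k) R Z)) - pd2 (Ψ 0) R Z * pd1 (F k) R Z +
      pd1 (Ψ 0) R Z * pd2 (F k) R Z = 0 := by
    intro R hR Z
    obtain ⟨QL, cL, QL0, hQL⟩ := factor_sum N k (fun l => (-e - l * γ) * F l R Z +
      γ * (R * pd1 (F l) R Z + Z * pd2 (F l) R Z)) (fun l hl => by simp [ih1 l hl R hR Z])
    obtain ⟨QF, cF, -, hQF⟩ := factor_sum N k (fun l => F l R Z)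
      (fun l hl => by simp [ih1 l hl R hR Z])
    obtain ⟨Q1, c1, Q10, hQ1⟩ := factor_sum N k (fun l => pd1 (F l) R Z)
      (fun l hl => by simp [ih1 l hl R hR Z])
    obtain ⟨Q2, c2, Q20, hQ2⟩ := factor_sum N k (fun l => pd2 (F l) R Z)
      (fun l hl => by simp [ih1 l hl R hR Z])
    obtain ⟨QP, cP, -, hQP⟩ := factor_sum N 0 (fun l => Ψ l R Z) (fun l hl => by omega)
    obtain ⟨QA, cQA, QA0, hQA⟩ := factor_sum N 0 (fun l => pd1 (Ψ l) R Z) (fun l hl => by omega)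
    obtain ⟨QB, cQB, QB0, hQB⟩ := factor_sum N 0 (fun l => pd2 (Ψ l) R Z) (fun l hl => by omega)
    simp only [hk, Nat.zero_le, if_true] at QL0 Q10 Q20 QA0 QB0
    obtain ⟨x0, hx0, hx⟩ := scale_exists (T := T) hδ hγ R Z hR
    have := limit_zero hx0 (fun x => QL x + (-((1 + x * R) * QB x)) * Q1 x +
      (2 * x * QP x + (1 + x * R) * QA x) * Q2 x - κ * x * QF x * QB x) (by fun_prop) (by
        intro x hxp hxl
        obtain ⟨s, hs, hsx, hC⟩ := hx x hxp hxl
        have E := heq _ _ _ hC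
        rw [rep_eval (rep_pdt hf dF) hxp hs hsx hC, rep_eval (rep_pdr hf dF) hxp hs hsx hC,
          rep_eval (rep_pdz hf dF) hxp hs hsx hC, rep_eval (rep_pdr hψ dΨ) hxp hs hsx hC,
          rep_eval (rep_pdz hψ dΨ) hxp hs hsx hC, rep_eval hf hxp hs hsx hC,
          rep_eval hψ hxp hs hsx hC, hQL, hQF, hQ1, hQ2, hQP, hQA, hQB] at E
        have p1 : s ^ (-1 + 2 * γ - γ) * s ^ (e - γ) = s ^ (e - 1) := by
          rw [← Real.rpow_add hs]; congr 1; ring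
        have p2 : s ^ (-1 + 2 * γ) * s ^ (e - γ) = s ^ (e - 1) * x := by
          rw [← hsx, ← Real.rpow_add hs, ← Real.rpow_add hs]; congr 1; ring
        have p3 : s ^ e * s ^ (-1 + 2 * γ - γ) = s ^ (e - 1) * x := by
          rw [← hsx, ← Real.rpow_add hs, ← Real.rpow_add hs]; congr 1; ring
        have hc : s ^ (e - 1) * x ^ k ≠ 0 := by positivity
        apply mul_left_cancel₀ hc
        simp only [pow_zero, one_mul] at E
        linear_combination E + ((1 + x * R) * QB x * x ^ k * Q1 x -
          (1 + x * R) * QA x * x ^ k * Q2 x) * p1 - 2 * QP x * x ^ k * Q2 x * p2 +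
          κ * x ^ k * QF x * QB x * p3)
    simp only [QL0, Q10, Q20, QA0, QB0] at this
    linear_combination this
  have hdec := hdecay k hk
  have hz := transport_zero γ (-e - k * γ) hγ (fun q => F k q.1 q.2)
    (fun q => γ * q.1 - B q) (fun q => γ * q.2 + A q) (hFreg k hk).continuousOn
    (ContinuousOn.sub (by fun_prop) cB) (ContinuousOn.add (by fun_prop) cA)
    (fun q hq => dF k hk q.1 hq q.2)
    (fun q hq => DifferentiableAt.sub (by fun_prop) (hAB q hq).2.2.2.1)
    (fun q hq => DifferentiableAt.add (by fun_prop) (hAB q hq).2.2.1)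
    (by
      intro q hq
      obtain ⟨-, -, dA, dB, -, -, hmix, -, -⟩ := hAB q hq
      have e1 : HasFDerivAt (fun q : ℝ × ℝ => γ * q.1 - B q)
        (γ • ContinuousLinearMap.fst ℝ ℝ ℝ - fderiv ℝ B q) q :=
        ((ContinuousLinearMap.fst ℝ ℝ ℝ).hasFDerivAt.const_mul γ).sub dB.hasFDerivAt
      have e2 : HasFDerivAt (fun q : ℝ × ℝ => γ * q.2 + A q)
        (γ • ContinuousLinearMap.snd ℝ ℝ ℝ + fderiv ℝ A q) q :=
        ((ContinuousLinearMap.snd ℝ ℝ ℝ).hasFDerivAt.const_mul γ).add dA.hasFDerivAt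
      rw [e1.fderiv, e2.fderiv]
      simp [hmix]
      ring)
    (by
      intro q hq
      have h1 := (fd_pd1 (F k) q.1 q.2 (dF k hk q.1 hq q.2)).2
      have h2 := (fd_pd2 (F k) q.1 q.2 (dF k hk q.1 hq q.2)).2
      have h3 := hpde q.1 hq q.2
      simp only [Prod.mk.eta] at h1 h2
      simp only [h1, h2, (hAB q hq).1, (hAB q hq).2.1]
      linear_combination h3)
    (by intro Z; simp [bB, hbc 0 (Nat.zero_le _)])
    hdec
  intro R hR Z
  exact hz (R, Z) hR

lemma rep_zero {T δ γ : ℝ} {N : ℕ} {e : ℝ} {F : ℕ → ℝ → ℝ → ℝ} {f : ℝ → ℝ → ℝ → ℝ}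
    (h : RepF T δ γ N e F f) (h0 : ∀ k ≤ N, ∀ R < 0, ∀ Z, F k R Z = 0) :
    ∀ r z t, CylC T δ r z t → f r z t = 0 := by
  intro r z t hC
  rw [h r z t hC]
  obtain ⟨h1, h2, h3, h4, h5, h6⟩ := hC
  rw [Finset.sum_eq_zero, mul_zero]
  intro k hk
  rw [h0 k (by simpa [Nat.lt_succ_iff] using hk), mul_zero]
  exact mul_neg_of_neg_of_pos (by linarith) (Real.rpow_pos_of_pos (by linarith) _)

lemma psi_zero {T δ γ : ℝ} (hδ : 0 < δ) (hδ1 : δ < 1) (hγ : 0 < γ) {N : ℕ}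
    {Ψ : ℕ → ℝ → ℝ → ℝ} {ψ1 : ℝ → ℝ → ℝ → ℝ}
    (hψ : RepF T δ γ N (-1 + 2 * γ) Ψ ψ1)
    (hΨreg : ∀ k ≤ N, ContDiffOn ℝ 2 (fun q : ℝ × ℝ => Ψ k q.1 q.2) {q : ℝ × ℝ | q.1 ≤ 0})
    (heq3 : ∀ r z t : ℝ, CylC T δ r z t →
      -(pdr (pdr ψ1) r z t + (3 / r) * pdr ψ1 r z t + pdz (pdz ψ1) r z t) = 0)
    (hgrad : ∀ k ≤ N, ∀ ε > 0, ∃ M : ℝ, ∀ R ≤ (0 : ℝ), ∀ Z : ℝ,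
      M < Real.sqrt (R ^ 2 + Z ^ 2) →
      Real.sqrt ((pd1 (Ψ k) R Z) ^ 2 + (pd2 (Ψ k) R Z) ^ 2)
        ≤ ε * Real.sqrt (R ^ 2 + Z ^ 2))
    (hbc : ∀ k ≤ N, ∀ Z : ℝ, pd2 (Ψ k) 0 Z = 0) :
    ∀ k ≤ N, ∀ R < 0, ∀ Z, pd1 (Ψ k) R Z = 0 ∧ pd2 (Ψ k) R Z = 0 := by
  have dΨ : ∀ k ≤ N, ∀ R < 0, ∀ Z,
      DifferentiableAt ℝ (fun q : ℝ × ℝ => Ψ k q.1 q.2) (R, Z) := fun k hk R hR Z =>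
    ((hΨreg k hk).contDiffAt (halfplane_nhds' (R, Z) hR)).differentiableAt (by norm_num)
  have dΨ1 : ∀ k ≤ N, ∀ R < 0, ∀ Z,
      DifferentiableAt ℝ (fun q : ℝ × ℝ => pd1 (Ψ k) q.1 q.2) (R, Z) := by
    intro k hk R hR Z
    obtain ⟨A, B, cA, cB, bB, hAB⟩ := psi_pack (Ψ k) (hΨreg k hk)
    exact (hAB (R, Z) hR).2.2.2.2.1
  have dΨ2 : ∀ k ≤ N, ∀ R < 0, ∀ Z,
      DifferentiableAt ℝ (fun q : ℝ × ℝ => pd2 (Ψ k) q.1 q.2) (R, Z) := by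
    intro k hk R hR Z
    obtain ⟨A, B, cA, cB, bB, hAB⟩ := psi_pack (Ψ k) (hΨreg k hk)
    exact (hAB (R, Z) hR).2.2.2.2.2.1
  have hser : ∀ R < 0, ∀ Z, ∃ x0 > 0, ∀ x, 0 < x → x < x0 →
      (1 + x * R) * ∑ k ∈ Finset.range (N + 1),
        x ^ k * (pd1 (pd1 (Ψ k)) R Z + pd2 (pd2 (Ψ k)) R Z) +
      3 * x * ∑ k ∈ Finset.range (N + 1), x ^ k * pd1 (Ψ k) R Z = 0 := by
    intro R hR Z
    obtain ⟨x0, hx0, hx⟩ := scale_exists (T := T) hδ hγ R Z hR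
    refine ⟨x0, hx0, fun x hxp hxl => ?_⟩
    obtain ⟨s, hs, hsx, hC⟩ := hx x hxp hxl
    have E := heq3 _ _ _ hC
    rw [rep_eval (rep_pdr (rep_pdr hψ dΨ) dΨ1) hxp hs hsx hC,
      rep_eval (rep_pdz (rep_pdz hψ dΨ) dΨ2) hxp hs hsx hC,
      rep_eval (rep_pdr hψ dΨ) hxp hs hsx hC] at E
    have hr : 0 < 1 + x * R := by have := hC.1; linarith
    have p1 : s ^ (-1 + 2 * γ - γ) = s ^ (-1 + 2 * γ - γ - γ) * x := by
      rw [← hsx, ← Real.rpow_add hs]; congr 1; ring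
    rw [p1] at E
    have hc : s ^ (-1 + 2 * γ - γ - γ) ≠ 0 := by positivity
    apply mul_left_cancel₀ hc
    simp only [mul_add, Finset.sum_add_distrib]
    field_simp at E
    linear_combination (-1 : ℝ) * E
  intro k
  induction k using Nat.strong_induction_on with
  | _ k ih =>
  intro hk
  have ihD : ∀ l < k, ∀ R < 0, ∀ Z, pd1 (pd1 (Ψ l)) R Z + pd2 (pd2 (Ψ l)) R Z = 0 := by
    intro l hl R hR Z
    have h0 := ih l hl (by omega)
    have e1 : (fun s => pd1 (Ψ l) s Z) =ᶠ[nhds R] fun _ => 0 := by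
      filter_upwards [Iio_mem_nhds hR] with s hs using (h0 s hs Z).1
    have e2 : (fun s => pd2 (Ψ l) R s) = fun _ => 0 := by
      funext s; exact (h0 R hR s).2
    have e1' : pd1 (pd1 (Ψ l)) R Z = 0 := by
      have := e1.deriv_eq
      simpa [pd1] using this
    have e2' : pd2 (pd2 (Ψ l)) R Z = 0 := by
      have := congrArg (fun g => deriv g Z) e2
      simpa [pd2] using this
    rw [e1', e2']; simp
  have hDk : ∀ R < 0, ∀ Z, pd1 (pd1 (Ψ k)) R Z + pd2 (pd2 (Ψ k)) R Z = 0 := by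
    intro R hR Z
    obtain ⟨QD, cD, QD0, hQD⟩ := factor_sum N k
      (fun l => pd1 (pd1 (Ψ l)) R Z + pd2 (pd2 (Ψ l)) R Z) (fun l hl => ihD l hl R hR Z)
    obtain ⟨QA, cA, QA0, hQA⟩ := factor_sum N k
      (fun l => pd1 (Ψ l) R Z) (fun l hl => (ih l hl (by omega) R hR Z).1)
    obtain ⟨x0, hx0, hx⟩ := hser R hR Z
    have := limit_zero hx0 (fun x => (1 + x * R) * QD x + 3 * x * QA x) (by fun_prop) (by
      intro x hxp hxl
      have E := hx x hxp hxl
      rw [hQD, hQA] at E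
      have hc : x ^ k ≠ 0 := by positivity
      apply mul_left_cancel₀ hc
      linear_combination E)
    simp only [hk, if_true] at QD0
    simp only [QD0] at this
    linear_combination this
  obtain ⟨-, d, hd⟩ := harm (Ψ k) (hΨreg k hk) (hgrad k hk) (hbc k hk) 0 hDk
  have hnext : ∀ R < 0, ∀ Z, (if k + 1 ≤ N then
      pd1 (pd1 (Ψ (k + 1))) R Z + pd2 (pd2 (Ψ (k + 1))) R Z else 0) = -3 * d := by
    intro R hR Z
    obtain ⟨QD, cD, QD0, hQD⟩ := factor_sum N (k + 1)
      (fun l => pd1 (pd1 (Ψ l)) R Z + pd2 (pd2 (Ψ l)) R Z) (fun l hl => by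
        rcases Nat.lt_succ_iff_lt_or_eq.1 hl with h | h
        · exact ihD l h R hR Z
        · subst h; exact hDk R hR Z)
    obtain ⟨QA, cA, QA0, hQA⟩ := factor_sum N k
      (fun l => pd1 (Ψ l) R Z) (fun l hl => (ih l hl (by omega) R hR Z).1)
    obtain ⟨x0, hx0, hx⟩ := hser R hR Z
    have := limit_zero hx0 (fun x => (1 + x * R) * QD x + 3 * QA x) (by fun_prop) (by
      intro x hxp hxl
      have E := hx x hxp hxl
      rw [hQD, hQA] at E
      have hc : x ^ (k + 1) ≠ 0 := by positivity
      apply mul_left_cancel₀ hc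
      linear_combination E)
    simp only [hk, if_true] at QA0
    simp only [QA0, (hd R hR Z).1] at this
    rw [← QD0]
    linear_combination this
  have hd0 : d = 0 := by
    by_cases hk1 : k + 1 ≤ N
    · simp only [hk1, if_true] at hnext
      have := (harm (Ψ (k + 1)) (hΨreg _ hk1) (hgrad _ hk1) (hbc _ hk1) (-3 * d) hnext).1
      linarith
    · have := hnext (-1) (by norm_num) 0
      rw [if_neg hk1] at this
      linarith
  intro R hR Z
  rw [← hd0]
  exact ⟨(hd R hR Z).1, hd0 ▸ (hd R hR Z).2⟩

/-- **Theorem 2 (generalized self-similar ansatz, finite expansion).**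
Let `T ∈ ℝ`, `0 < δ < 1`, `γ > 0`, `N ≥ 0` an integer, `p` a positive even integer.
Let `(u₁, ω₁, ψ₁)` be a classical solution of the reduced axisymmetric Euler system on
`𝒞_{δ,T}` admitting the generalized self-similar representation
`u₁ = (T−t)^{−1+γ/2} Σ_{k=0}^{N} (T−t)^{kγ} U_k(R,Z)`,
`ω₁ = (T−t)^{−1} Σ_{k=0}^{N} (T−t)^{kγ} Ω_k(R,Z)`,
`ψ₁ = (T−t)^{−1+2γ} Σ_{k=0}^{N} (T−t)^{kγ} Ψ_k(R,Z)`,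
with `R = (r−1)(T−t)^{−γ}`, `Z = z(T−t)^{−γ}` (real powers), where the profiles
`U_k, Ω_k` are `C¹` and `Ψ_k` is `C²` up to the boundary of the closed left half-plane
`𝒟 = {(R,Z) : R ≤ 0}`.  Assume for each `k ≤ N`: `|U_k| + |Ω_k| → 0` and
`|∇Ψ_k(Y)|/|Y| → 0` as `|Y| → ∞` in `𝒟`; `∂_Z Ψ_k(0,Z) = 0` for all `Z`; and, whenever
`k ≤ 1/γ`, the annulus integrals of `U_k^p + Ω_k^p` tend to `0`.  Then `u₁ ≡ 0`,
`ω₁ ≡ 0`, `∂_r ψ₁ ≡ 0` and `∂_z ψ₁ ≡ 0` on `𝒞_{δ,T}`. -/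
theorem generalized_ansatz_trivial
    (T δ γ : ℝ) (hδ0 : 0 < δ) (hδ1 : δ < 1) (hγ : 0 < γ)
    (N : ℕ) (p : ℕ) (hp : 0 < p) (hpeven : Even p)
    (u1 ω1 ψ1 : ℝ → ℝ → ℝ → ℝ) (U W Ψ : ℕ → ℝ → ℝ → ℝ)
    (inC : ℝ → ℝ → ℝ → Prop)
    (hinC : ∀ r z t : ℝ, inC r z t ↔
      (1 - δ < r ∧ r < 1 ∧ -δ < z ∧ z < δ ∧ T - δ < t ∧ t < T))
    -- regularity of the classical solution
    (hu1reg : ContDiffOn ℝ 1 (fun q : ℝ × ℝ × ℝ => u1 q.1 q.2.1 q.2.2)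
      {q : ℝ × ℝ × ℝ | inC q.1 q.2.1 q.2.2})
    (hω1reg : ContDiffOn ℝ 1 (fun q : ℝ × ℝ × ℝ => ω1 q.1 q.2.1 q.2.2)
      {q : ℝ × ℝ × ℝ | inC q.1 q.2.1 q.2.2})
    (hψ1reg : ContDiffOn ℝ 1 (fun q : ℝ × ℝ × ℝ => ψ1 q.1 q.2.1 q.2.2)
      {q : ℝ × ℝ × ℝ | inC q.1 q.2.1 q.2.2})
    (hψ1reg2 : ∀ t : ℝ, ContDiffOn ℝ 2 (fun q : ℝ × ℝ => ψ1 q.1 q.2 t)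
      {q : ℝ × ℝ | 1 - δ < q.1 ∧ q.1 < 1 ∧ -δ < q.2 ∧ q.2 < δ})
    -- the reduced axisymmetric Euler system, with
    -- `uʳ = −r ∂_z ψ₁` and `u^z = 2ψ₁ + r ∂_r ψ₁`
    (heq1 : ∀ r z t : ℝ, inC r z t →
      pdt u1 r z t + (-(r * pdz ψ1 r z t)) * pdr u1 r z t
        + (2 * ψ1 r z t + r * pdr ψ1 r z t) * pdz u1 r z t
        = 2 * u1 r z t * pdz ψ1 r z t)
    (heq2 : ∀ r z t : ℝ, inC r z t →
      pdt ω1 r z t + (-(r * pdz ψ1 r z t)) * pdr ω1 r z t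
        + (2 * ψ1 r z t + r * pdr ψ1 r z t) * pdz ω1 r z t
        = pdz (fun a b c => (u1 a b c) ^ 2) r z t)
    (heq3 : ∀ r z t : ℝ, inC r z t →
      -(pdr (pdr ψ1) r z t + (3 / r) * pdr ψ1 r z t + pdz (pdz ψ1) r z t)
        = ω1 r z t)
    -- regularity of the blow-up profiles, up to the boundary of `𝒟`
    (hUreg : ∀ k ≤ N, ContDiffOn ℝ 1 (fun q : ℝ × ℝ => U k q.1 q.2)
      {q : ℝ × ℝ | q.1 ≤ 0})
    (hWreg : ∀ k ≤ N, ContDiffOn ℝ 1 (fun q : ℝ × ℝ => W k q.1 q.2)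
      {q : ℝ × ℝ | q.1 ≤ 0})
    (hΨreg : ∀ k ≤ N, ContDiffOn ℝ 2 (fun q : ℝ × ℝ => Ψ k q.1 q.2)
      {q : ℝ × ℝ | q.1 ≤ 0})
    -- the generalized self-similar ansatz
    (hrepu : ∀ r z t : ℝ, inC r z t →
      u1 r z t = (T - t) ^ (-1 + γ / 2) *
        ∑ k ∈ Finset.range (N + 1), (T - t) ^ ((k : ℝ) * γ) *
          U k ((r - 1) * (T - t) ^ (-γ)) (z * (T - t) ^ (-γ)))
    (hrepω : ∀ r z t : ℝ, inC r z t →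
      ω1 r z t = (T - t) ^ (-(1 : ℝ)) *
        ∑ k ∈ Finset.range (N + 1), (T - t) ^ ((k : ℝ) * γ) *
          W k ((r - 1) * (T - t) ^ (-γ)) (z * (T - t) ^ (-γ)))
    (hrepψ : ∀ r z t : ℝ, inC r z t →
      ψ1 r z t = (T - t) ^ (-1 + 2 * γ) *
        ∑ k ∈ Finset.range (N + 1), (T - t) ^ ((k : ℝ) * γ) *
          Ψ k ((r - 1) * (T - t) ^ (-γ)) (z * (T - t) ^ (-γ)))
    -- decay of the profiles as `|Y| → ∞` in `𝒟`
    (hdecay : ∀ k ≤ N, ∀ ε > 0, ∃ M : ℝ, ∀ R ≤ (0 : ℝ), ∀ Z : ℝ,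
      M < Real.sqrt (R ^ 2 + Z ^ 2) → |U k R Z| + |W k R Z| < ε)
    -- sublinearity of `∇Ψ_k` as `|Y| → ∞` in `𝒟`
    (hgrad : ∀ k ≤ N, ∀ ε > 0, ∃ M : ℝ, ∀ R ≤ (0 : ℝ), ∀ Z : ℝ,
      M < Real.sqrt (R ^ 2 + Z ^ 2) →
      Real.sqrt ((pd1 (Ψ k) R Z) ^ 2 + (pd2 (Ψ k) R Z) ^ 2)
        ≤ ε * Real.sqrt (R ^ 2 + Z ^ 2))
    -- boundary condition `∂_Z Ψ_k(0,Z) = 0`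
    (hbc : ∀ k ≤ N, ∀ Z : ℝ, pd2 (Ψ k) 0 Z = 0)
    -- annulus integral condition for `k ≤ 1/γ`
    (hint : ∀ k ≤ N, (k : ℝ) ≤ 1 / γ → Tendsto (fun ρ : ℝ =>
      ∫ q in {q : ℝ × ℝ | q.1 ≤ 0 ∧ ρ < Real.sqrt (q.1 ^ 2 + q.2 ^ 2)
                ∧ Real.sqrt (q.1 ^ 2 + q.2 ^ 2) < 2 * ρ},
        ((U k q.1 q.2) ^ p + (W k q.1 q.2) ^ p))
      atTop (nhds 0)) :
    ∀ r z t : ℝ, inC r z t →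
      u1 r z t = 0 ∧ ω1 r z t = 0 ∧ pdr ψ1 r z t = 0 ∧ pdz ψ1 r z t = 0 := by
  have hinC' : inC = CylC T δ := by
    funext r z t; exact propext (hinC r z t)
  subst hinC'
  have ru : RepF T δ γ N (-1 + γ / 2) U u1 := hrepu
  have rω : RepF T δ γ N (-(1 : ℝ)) W ω1 := hrepω
  have rψ : RepF T δ γ N (-1 + 2 * γ) Ψ ψ1 := hrepψ
  have hU0 := family_zero hδ0 hγ (κ := 2) ru rψ hUreg hΨreg heq1 (by
    intro k hk ε hε
    obtain ⟨M, hM⟩ := hdecay k hk ε hε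
    exact ⟨M, fun R hR Z h => by linarith [hM R hR Z h, abs_nonneg (W k R Z)]⟩) hbc
  have hu0 := rep_zero ru (fun k hk R hR Z => hU0 k hk R hR.le Z)
  have hW0 := family_zero hδ0 hγ (κ := 0) rω rψ hWreg hΨreg (by
    intro r z t hC
    rw [heq2 r z t hC]
    obtain ⟨h1, h2, h3, h4, h5, h6⟩ := hC
    have ev : (fun s => (u1 r s t) ^ 2) =ᶠ[nhds z] fun _ => 0 := by
      filter_upwards [Ioo_mem_nhds h3 h4] with s hs
      rw [hu0 r s t ⟨h1, h2, hs.1, hs.2, h5, h6⟩]; norm_num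
    simp only [pdz]
    rw [ev.deriv_eq]; simp) (by
    intro k hk ε hε
    obtain ⟨M, hM⟩ := hdecay k hk ε hε
    exact ⟨M, fun R hR Z h => by linarith [hM R hR Z h, abs_nonneg (U k R Z)]⟩) hbc
  have hω0 := rep_zero rω (fun k hk R hR Z => hW0 k hk R hR.le Z)
  have hΨ0 := psi_zero hδ0 hδ1 hγ rψ hΨreg
    (fun r z t hC => by rw [heq3 r z t hC, hω0 r z t hC]) hgrad hbc
  have dΨ : ∀ k ≤ N, ∀ R < 0, ∀ Z,
      DifferentiableAt ℝ (fun q : ℝ × ℝ => Ψ k q.1 q.2) (R, Z) := fun k hk R hR Z =>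
    ((hΨreg k hk).contDiffAt (halfplane_nhds' (R, Z) hR)).differentiableAt (by norm_num)
  have hr0 := rep_zero (rep_pdr rψ dΨ) (fun k hk R hR Z => (hΨ0 k hk R hR Z).1)
  have hz0 := rep_zero (rep_pdz rψ dΨ) (fun k hk R hR Z => (hΨ0 k hk R hR Z).2)
  intro r z t hC
  exact ⟨hu0 r z t hC, hω0 r z t hC, hr0 r z t hC, hz0 r z t hC⟩
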